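/- Fix λ ∈ ℂ with λ ≠ 0, let R = P/Q be a non-constant rational function (P, Q ∈ ℂ[X] coprime, Q ≠ 0, max(deg P, deg Q) ≥ 1) such that Q has no roots in ℂ∖{0} (i.e., R has no poles in ℂ* = ℂ∖{0}), and let a, b ∈ ℂ with a ≠ b. If R and ∂_z R share the value a in ℂ* and also share the value b in ℂ*, then P·Q = λ·X·(P'·Q − P·Q') in ℂ[X] (i.e., R ≡ ∂_z R). -/

import Mathlib

open Polynomial

theorem dvd_derivative_mul_of_roots {K : Type*} [Field K] [IsAlgClosed K] [CharZero K]
    {F G : K[X]} (hF : F ≠ 0) (h : ∀ w, F.eval w = 0 → G.eval w = 0) :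
    F ∣ derivative F * G := by
  classical
  rcases eq_or_ne (derivative F * G) 0 with h0 | h0
  · simp [h0]
  rw [IsAlgClosed.dvd_iff_roots_le_roots hF h0, Multiset.le_iff_count]
  intro w
  rw [count_roots, count_roots, rootMultiplicity_mul h0]
  by_cases hw : F.eval w = 0
  · have h1 := rootMultiplicity_sub_one_le_derivative_rootMultiplicity F w
    have h2 : 0 < G.rootMultiplicity w :=
      (rootMultiplicity_pos (right_ne_zero_of_mul h0)).2 (h w hw)
    omega
  · simp [rootMultiplicity_eq_zero hw]

theorem dvd_of_simple_roots {K : Type*} [Field K] [IsAlgClosed K] [CharZero K]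
    {F G : K[X]} (hF : F ≠ 0) (hs : ∀ w, F.eval w = 0 → (derivative F).eval w ≠ 0)
    (h : ∀ w, F.eval w = 0 → G.eval w = 0) : F ∣ G := by
  have hc : IsCoprime F (derivative F) := by
    rw [isCoprime_iff_aeval_ne_zero_of_isAlgClosed K K]
    intro w
    simp only [coe_aeval_eq_eval]
    exact or_iff_not_imp_left.2 fun hw => hs w (not_not.1 hw)
  exact hc.dvd_of_dvd_mul_left (dvd_derivative_mul_of_roots hF h)

theorem isCoprime_of_sub_eq_C {K : Type*} [Field K] {F G : K[X]} {c : K} (hc : c ≠ 0)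
    (h : F - G = C c) : IsCoprime F G :=
  ⟨C c⁻¹, -C c⁻¹, by
    rw [neg_mul, ← sub_eq_add_neg, ← mul_sub, h, ← C_mul, inv_mul_cancel₀ hc, C_1]⟩

theorem sub_C_ne_zero_of_natDegree_pos {R : Type*} [Ring R] {P : R[X]} (hd : 1 ≤ P.natDegree)
    (v : R) : P - C v ≠ 0 := fun h => by
  have := natDegree_sub_C (p := P) (a := v)
  rw [h, natDegree_zero] at this
  omega

theorem eq_C_mul_of_dvd_of_natDegree_le {K : Type*} [Field K] {F G : K[X]} (hF : F ≠ 0)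
    (h : F ∣ G) (hd : G.natDegree ≤ F.natDegree) : ∃ c, G = C c * F := by
  obtain ⟨q, rfl⟩ := h
  rcases eq_or_ne q 0 with rfl | hq
  · exact ⟨0, by simp⟩
  rw [natDegree_mul hF hq] at hd
  exact ⟨q.coeff 0, by rw [← eq_C_of_natDegree_le_zero (by omega), mul_comm]⟩

theorem coeff_X_mul_derivative {R : Type*} [CommRing R] (P : R[X]) (k : ℕ) :
    (X * derivative P).coeff k = k * P.coeff k := by
  cases k with
  | zero => simp
  | succ k => rw [coeff_X_mul, coeff_derivative]; push_cast; ring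

theorem coeff_C_mul_X_mul_derivative {R : Type*} [CommRing R] (l : R) (P : R[X]) (k : ℕ) :
    (C l * X * derivative P).coeff k = l * k * P.coeff k := by
  rw [mul_assoc, coeff_C_mul, coeff_X_mul_derivative, mul_assoc]

theorem natDegree_C_mul_X_mul_derivative_le {R : Type*} [CommRing R] (l : R) (P : R[X]) :
    (C l * X * derivative P).natDegree ≤ P.natDegree := by
  rw [natDegree_le_iff_coeff_eq_zero]
  intro N hN
  rw [coeff_C_mul_X_mul_derivative, coeff_eq_zero_of_natDegree_lt hN, mul_zero]

/-- If `P` and `E = l X P'` share `a` and `b`, then `(P, E)` lies on a conic. -/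
theorem exists_conic_relation {l a b : ℂ} {P : ℂ[X]} (hd : 1 ≤ P.natDegree) (hab : a ≠ b)
    (ha : ∀ w : ℂ, w ≠ 0 → P.eval w = a → l * w * (derivative P).eval w = a)
    (hb : ∀ w : ℂ, w ≠ 0 → P.eval w = b → l * w * (derivative P).eval w = b) :
    ∃ c, C l * X * derivative P * (C l * X * derivative P - P) = C c * ((P - C a) * (P - C b)) := by
  have hne : ∀ s, P - C s ≠ 0 := sub_C_ne_zero_of_natDegree_pos hd
  have key : ∀ s, (∀ w : ℂ, w ≠ 0 → P.eval w = s → l * w * (derivative P).eval w = s) →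
      P - C s ∣ C l * X * derivative P * (C l * X * derivative P - P) := by
    intro s hs
    have h1 := dvd_derivative_mul_of_roots (G := C l * X * (C l * X * derivative P - P)) (hne s) (by
      intro w hw
      have hw' : P.eval w = s := by simpa [sub_eq_zero] using hw
      rcases eq_or_ne w 0 with rfl | h0
      · simp
      · simp [hs w h0 hw', hw'])
    convert h1 using 1
    simp; ring
  have hE := natDegree_C_mul_X_mul_derivative_le l P
  refine eq_C_mul_of_dvd_of_natDegree_le (mul_ne_zero (hne a) (hne b)) ?_ ?_
  · refine IsCoprime.mul_dvd (isCoprime_of_sub_eq_C (c := b - a) (sub_ne_zero.2 hab.symm) ?_)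
      (key a ha) (key b hb)
    simp
  · rw [natDegree_mul (hne a) (hne b), natDegree_sub_C, natDegree_sub_C]
    refine natDegree_mul_le.trans (add_le_add hE ?_)
    exact (natDegree_sub_le _ _).trans (max_le hE le_rfl)

/-- On the conic, the point other than `(v, s)` above `v` is `(v, v - s)`, so `E = v - s` holds at
every root of `P - v`. -/
theorem exists_linear_relation_of_conic {l c s t v : ℂ} {P : ℂ[X]} (hd : 1 ≤ P.natDegree)
    (hconic : C l * X * derivative P * (C l * X * derivative P - P) =
      C c * ((P - C s) * (P - C t)))
    (hs : ∀ w : ℂ, w ≠ 0 → l * w * (derivative P).eval w = s → P.eval w = s)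
    (hv : c * (v - t) = -s) (hv0 : v ≠ P.eval 0) (hvs : v ≠ s) :
    ∃ e, C l * X * derivative P = P - C s + C e * (P - C v) := by
  have hne : P - C v ≠ 0 := sub_C_ne_zero_of_natDegree_pos hd v
  have key : ∀ w, (P - C v).eval w = 0 → l * w * (derivative P).eval w = v - s := by
    intro w hw
    have hw' : P.eval w = v := by simpa [sub_eq_zero] using hw
    have hw0 : w ≠ 0 := by rintro rfl; exact hv0 hw'.symm
    have h1 := congrArg (eval w) hconic
    simp only [eval_mul, eval_sub, eval_C, eval_X, hw'] at h1
    have h2 : l * w * (derivative P).eval w ≠ s := fun h => hvs (hw' ▸ hs w hw0 h)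
    have h3 : (l * w * (derivative P).eval w - s) *
        (l * w * (derivative P).eval w - (v - s)) = 0 := by
      linear_combination h1 + (v - s) * hv
    exact sub_eq_zero.1 ((mul_eq_zero.1 h3).resolve_left (sub_ne_zero.2 h2))
  have hdvd : P - C v ∣ C l * X * derivative P - P + C s := by
    refine dvd_of_simple_roots hne (fun w hw h0 => ?_) (fun w hw => ?_)
    · have := key w hw
      simp only [derivative_sub, derivative_C, sub_zero] at h0
      rw [h0, mul_zero] at this
      exact hvs (sub_eq_zero.1 this.symm)
    · have hw' : P.eval w = v := by simpa [sub_eq_zero] using hw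
      simp [key w hw, hw']
  obtain ⟨e, he⟩ := eq_C_mul_of_dvd_of_natDegree_le hne hdvd (by
    rw [natDegree_sub_C]
    refine (natDegree_add_C).le.trans ((natDegree_sub_le _ _).trans
      (max_le (natDegree_C_mul_X_mul_derivative_le l P) le_rfl)))
  exact ⟨e, by linear_combination he⟩

theorem conic_relation_false {l a b c : ℂ} {P : ℂ[X]} (hd : 1 ≤ P.natDegree) (hab : a ≠ b)
    (ha : ∀ w : ℂ, w ≠ 0 → l * w * (derivative P).eval w = a → P.eval w = a)
    (hb : ∀ w : ℂ, w ≠ 0 → l * w * (derivative P).eval w = b → P.eval w = b)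
    (hconic : C l * X * derivative P * (C l * X * derivative P - P) =
      C c * ((P - C a) * (P - C b)))
    (hc : c = l * P.natDegree * (l * P.natDegree - 1)) (hc0 : c ≠ 0) (h0 : P.eval 0 = b) :
    False := by
  have hlead : P.coeff P.natDegree ≠ 0 := by
    rw [coeff_natDegree, Ne, leadingCoeff_eq_zero]; rintro rfl; simp at hd
  have hne : P - C b ≠ 0 := sub_C_ne_zero_of_natDegree_pos hd b
  obtain ⟨g, hg, hndvd⟩ := exists_eq_pow_rootMultiplicity_mul_and_not_dvd (P - C b) hne 0
  have hNpos : 0 < (P - C b).rootMultiplicity 0 := (rootMultiplicity_pos hne).2 (by simp [h0])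
  generalize (P - C b).rootMultiplicity 0 = N at hg hNpos
  simp only [C_0, sub_zero] at hg hndvd
  rw [X_dvd_iff, coeff_zero_eq_eval_zero] at hndvd
  have hg0 : g ≠ 0 := by rintro rfl; simp at hndvd
  have hdeg : P.natDegree = N + g.natDegree := by
    rw [← natDegree_sub_C (p := P) (a := b), hg, natDegree_mul (pow_ne_zero _ X_ne_zero) hg0,
      natDegree_X_pow]
  have hPe : P = X ^ N * g + C b := by rw [← hg]; ring
  have hE : C l * X * derivative P = X ^ N * (C l * (C (N : ℂ) * g + X * derivative g)) := by
    obtain ⟨M, rfl⟩ := Nat.exists_eq_succ_of_ne_zero hNpos.ne'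
    have : derivative P = derivative (X ^ (M + 1) * g) := by
      conv_lhs => rw [hPe]
      simp
    rw [this, derivative_mul, derivative_X_pow]
    simp only [Nat.succ_eq_add_one, Nat.add_sub_cancel]
    ring
  have hrel : l * N * (-b) = c * (b - a) := by
    have h1 : X ^ N * ((C l * (C (N : ℂ) * g + X * derivative g)) * (C l * X * derivative P - P)) =
        X ^ N * (C c * ((P - C a) * g)) := by
      have h2 := hconic
      rw [hg] at h2
      nth_rewrite 1 [hE] at h2
      linear_combination h2
    have h2 := congrArg (eval 0) (mul_left_cancel₀ (pow_ne_zero _ X_ne_zero) h1)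
    simp only [eval_mul, eval_sub, eval_add, eval_C, eval_X, h0] at h2
    refine mul_left_cancel₀ hndvd ?_
    linear_combination h2
  have hgc : P.coeff N = g.eval 0 := by
    rw [hPe, coeff_add, coeff_X_pow_mul', coeff_C, if_neg hNpos.ne']
    simp [coeff_zero_eq_eval_zero]
  have hreal : l * N = 1 → c * N ^ 2 = ((N + g.natDegree) * g.natDegree : ℕ) := by
    intro h
    rw [hc, hdeg]; push_cast
    linear_combination ((N + g.natDegree : ℂ) ^ 2 * (l * N + 1) - N * (N + g.natDegree)) * h
  have hlin : ∀ e s v, C l * X * derivative P = P - C s + C e * (P - C v) →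
      l * P.natDegree = 1 + e ∧ l * N = 1 + e ∧ b - s + e * (b - v) = 0 := by
    intro e s v h
    have hk : ∀ k : ℕ, k ≠ 0 → P.coeff k ≠ 0 → l * k = 1 + e := by
      intro k hk hPk
      have := congrArg (fun p => coeff p k) h
      simp only [coeff_C_mul_X_mul_derivative, coeff_add, coeff_sub, coeff_C_mul, coeff_C,
        if_neg hk] at this
      exact mul_right_cancel₀ hPk (by linear_combination this)
    refine ⟨hk _ (by omega) hlead, hk N hNpos.ne' (hgc ▸ hndvd), ?_⟩
    have := congrArg (eval 0) h
    simp [h0] at this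
    linear_combination -this
  have hvb : a - b / c = b := by
    by_contra hv
    obtain ⟨e, he⟩ := exists_linear_relation_of_conic (s := b) (t := a) (v := a - b / c) hd
      (by rw [hconic]; ring) hb (by field_simp; ring) (by rwa [h0]) hv
    obtain ⟨h1, -, h3⟩ := hlin _ _ _ he
    have : e = 0 := by
      have : e * (b - (a - b / c)) = 0 := by linear_combination h3
      exact (mul_eq_zero.1 this).resolve_right (sub_ne_zero.2 (Ne.symm hv))
    subst this
    exact hc0 (by rw [hc, h1]; ring)
  have hcb : b = c * (a - b) := by
    field_simp at hvb
    linear_combination -hvb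
  have hb0 : b ≠ 0 := by
    rintro rfl
    exact (mul_ne_zero hc0 (sub_ne_zero.2 hab)) hcb.symm
  have hlN : l * N = 1 := mul_right_cancel₀ hb0 (by linear_combination -hrel - hcb)
  have hcN := hreal hlN
  have ha0 : a ≠ 0 := by
    rintro rfl
    have : c = -1 := mul_right_cancel₀ hb0 (by linear_combination hcb)
    rw [this] at hcN
    have h2 : N ^ 2 + (N + g.natDegree) * g.natDegree = 0 := by
      have : ((N ^ 2 + (N + g.natDegree) * g.natDegree : ℕ) : ℂ) = 0 := by
        push_cast at hcN ⊢; linear_combination -hcN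
      exact_mod_cast this
    nlinarith
  have hva : b - a / c ≠ a := by
    intro h
    have h1 : a = c * (b - a) := by field_simp at h; linear_combination -h
    have h2 : a = -b := by linear_combination h1 + hcb
    have : 2 * c = -1 := mul_right_cancel₀ hb0 (by rw [h2] at hcb; linear_combination hcb)
    have h2 : N ^ 2 + 2 * ((N + g.natDegree) * g.natDegree) = 0 := by
      have : ((N ^ 2 + 2 * ((N + g.natDegree) * g.natDegree) : ℕ) : ℂ) = 0 := by
        push_cast at hcN ⊢; linear_combination -2 * hcN + N ^ 2 * this
      exact_mod_cast this
    nlinarith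
  obtain ⟨e, he⟩ := exists_linear_relation_of_conic (s := a) (t := b) (v := b - a / c) hd hconic ha
    (by field_simp; ring) (by rw [h0]; simp [ha0, hc0]) hva
  obtain ⟨-, h2, h3⟩ := hlin _ _ _ he
  have : e = 0 := by linear_combination hlN - h2
  subst this
  exact hab (by linear_combination -h3)

theorem eq_C_mul_X_mul_derivative_of_share {l a b : ℂ} {P : ℂ[X]} (hl : l ≠ 0)
    (hd : 1 ≤ P.natDegree) (hab : a ≠ b)
    (ha : ∀ w : ℂ, w ≠ 0 → (P.eval w = a ↔ l * w * (derivative P).eval w = a))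
    (hb : ∀ w : ℂ, w ≠ 0 → (P.eval w = b ↔ l * w * (derivative P).eval w = b)) :
    P = C l * X * derivative P := by
  obtain ⟨c, hconic⟩ := exists_conic_relation hd hab
    (fun w hw => (ha w hw).1) (fun w hw => (hb w hw).1)
  have hlead : P.coeff P.natDegree ≠ 0 := by
    rw [coeff_natDegree, Ne, leadingCoeff_eq_zero]; rintro rfl; simp at hd
  have hc : c = l * P.natDegree * (l * P.natDegree - 1) := by
    have hE := natDegree_C_mul_X_mul_derivative_le l P
    have h1 := congrArg (fun p => coeff p (P.natDegree + P.natDegree)) hconic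
    have hs : ∀ s, (P - C s).natDegree ≤ P.natDegree := fun s => natDegree_sub_C.le
    have hk : ∀ s, (P - C s).coeff P.natDegree = P.coeff P.natDegree := fun s => by
      rw [coeff_sub, coeff_C, if_neg (by omega), sub_zero]
    rw [coeff_C_mul, coeff_mul_add_eq_of_natDegree_le hE
      ((natDegree_sub_le _ _).trans (max_le hE le_rfl)),
      coeff_mul_add_eq_of_natDegree_le (hs a) (hs b), hk, hk, coeff_sub,
      coeff_C_mul_X_mul_derivative] at h1
    exact mul_right_cancel₀ (mul_ne_zero hlead hlead) (by linear_combination -h1)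
  rcases eq_or_ne c 0 with hc0 | hc0
  · rw [hc0, C_0, zero_mul] at hconic
    rcases mul_eq_zero.1 hconic with h | h
    · have := congrArg (fun p => coeff p P.natDegree) h
      simp only [coeff_C_mul_X_mul_derivative, coeff_zero] at this
      have hdc : (P.natDegree : ℂ) ≠ 0 := by exact_mod_cast (by omega)
      exact absurd this (mul_ne_zero (mul_ne_zero hl hdc) hlead)
    · exact (sub_eq_zero.1 h).symm
  · exfalso
    have h1 := congrArg (eval 0) hconic
    simp only [eval_mul, eval_X, eval_C, mul_zero, zero_mul, eval_sub, zero_eq_mul, hc0,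
      false_or] at h1
    rcases (mul_eq_zero.1 h1).imp sub_eq_zero.1 sub_eq_zero.1 with h1 | h1
    · exact conic_relation_false hd hab.symm (fun w hw => (hb w hw).2) (fun w hw => (ha w hw).2)
        (by rw [hconic]; ring) hc hc0 h1
    · exact conic_relation_false hd hab (fun w hw => (ha w hw).2) (fun w hw => (hb w hw).2)
        hconic hc hc0 h1

theorem eq_of_share_of_lt_natDegree {l a b : ℂ} {P : ℂ[X]} {n : ℕ} (hn : 0 < n)
    (hnd : n < P.natDegree) (hP0 : P.eval 0 ≠ 0) (hab : a ≠ b) (hb0 : b ≠ 0)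
    (ha : ∀ w : ℂ, w ≠ 0 → P.eval w = a * w ^ n →
      l * (w * (derivative P).eval w - n * P.eval w) = a * w ^ n)
    (hb : ∀ w : ℂ, w ≠ 0 → P.eval w = b * w ^ n →
      l * (w * (derivative P).eval w - n * P.eval w) = b * w ^ n) :
    P = C l * (X * derivative P - C (n : ℂ) * P) := by
  have hdeg : ∀ s : ℂ, (P - C s * X ^ n).natDegree = P.natDegree := fun s =>
    natDegree_sub_eq_left_of_natDegree_lt ((natDegree_C_mul_X_pow_le s n).trans_lt hnd)
  have hroot : ∀ s w : ℂ, (P - C s * X ^ n).eval w = 0 → w ≠ 0 ∧ P.eval w = s * w ^ n := by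
    intro s w hw
    have hw' : P.eval w = s * w ^ n := by simpa [sub_eq_zero] using hw
    refine ⟨?_, hw'⟩
    rintro rfl
    exact hP0 (by rw [hw', zero_pow hn.ne', mul_zero])
  have hFne : P - C b * X ^ n ≠ 0 := fun h => by
    have := hdeg b
    rw [h, natDegree_zero] at this
    omega
  have hdvd : P - C b * X ^ n ∣ C l * (X * derivative P - C (n : ℂ) * P) - P := by
    refine dvd_of_simple_roots hFne (fun w hw h0 => ?_) (fun w hw => ?_)
    · obtain ⟨hw0, hw'⟩ := hroot b w hw
      have h1 := hb w hw0 hw'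
      simp only [derivative_sub, derivative_C_mul, derivative_X_pow, eval_sub, eval_mul, eval_C,
        eval_pow, eval_X] at h0
      have h2 : w * w ^ (n - 1) = w ^ n := by rw [← pow_succ', Nat.sub_add_cancel hn]
      refine mul_ne_zero hb0 (pow_ne_zero n hw0) ?_
      linear_combination -h1 + l * w * h0 + l * b * n * h2 - l * n * hw'
    · obtain ⟨hw0, hw'⟩ := hroot b w hw
      have h1 := hb w hw0 hw'
      simp only [eval_sub, eval_mul, eval_C, eval_X]
      rw [h1, hw', sub_self]
  obtain ⟨z, hz⟩ := IsAlgClosed.exists_root (P - C a * X ^ n)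
    (natDegree_pos_iff_degree_pos.1 (by rw [hdeg]; omega)).ne'
  obtain ⟨hz0, hz'⟩ := hroot a z hz
  obtain ⟨e, he⟩ := eq_C_mul_of_dvd_of_natDegree_le hFne hdvd (by
    rw [hdeg]
    refine (natDegree_sub_le _ _).trans (max_le ?_ le_rfl)
    refine (natDegree_C_mul_le _ _).trans ((natDegree_sub_le _ _).trans
      (max_le ?_ (natDegree_C_mul_le _ _)))
    simpa using natDegree_C_mul_X_mul_derivative_le 1 P)
  have h1 := congrArg (eval z) he
  simp only [eval_sub, eval_mul, eval_C, eval_X, eval_pow] at h1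
  rw [ha z hz0 hz', hz', sub_self, ← sub_mul] at h1
  have he0 : e = 0 := (mul_eq_zero.1 h1.symm).resolve_right
    (mul_ne_zero (sub_ne_zero.2 hab) (pow_ne_zero n hz0))
  rw [he0, C_0, zero_mul] at he
  exact (sub_eq_zero.1 he).symm

theorem X_mul_derivative_reflect {R : Type*} [CommRing R] {P : R[X]} {n : ℕ}
    (hd : P.natDegree ≤ n) :
    X * derivative (reflect n P) = reflect n (C (n : R) * P - X * derivative P) := by
  ext k
  rw [coeff_X_mul_derivative, coeff_reflect, coeff_reflect, coeff_sub, coeff_C_mul,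
    coeff_X_mul_derivative]
  rcases le_or_gt k n with h | h
  · rw [revAt_le h, Nat.cast_sub h]
    ring
  · rw [revAt_eq_self_of_lt h, coeff_eq_zero_of_natDegree_lt (hd.trans_lt h)]
    ring

theorem eval_reflect {K : Type*} [Field K] {P : K[X]} {n : ℕ}
    (hd : P.natDegree ≤ n) {w : K} (hw : w ≠ 0) :
    P.eval w = (reflect n P).eval w⁻¹ * w ^ n := by
  let _ := invertibleOfNonzero hw
  have := eval₂_reflect_mul_pow (RingHom.id K) w n P hd
  rw [invOf_eq_inv] at this
  exact this.symm

theorem eq_of_share_of_natDegree_le {l a b : ℂ} {P : ℂ[X]} {n : ℕ} (hl : l ≠ 0) (hn : 0 < n)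
    (hnd : P.natDegree ≤ n) (hP0 : P.eval 0 ≠ 0) (hab : a ≠ b)
    (ha : ∀ w : ℂ, w ≠ 0 → (P.eval w = a * w ^ n ↔
      l * (w * (derivative P).eval w - n * P.eval w) = a * w ^ n))
    (hb : ∀ w : ℂ, w ≠ 0 → (P.eval w = b * w ^ n ↔
      l * (w * (derivative P).eval w - n * P.eval w) = b * w ^ n)) :
    P = C l * (X * derivative P - C (n : ℂ) * P) := by
  have hdE : (C (n : ℂ) * P - X * derivative P).natDegree ≤ n := by
    refine (natDegree_sub_le _ _).trans (max_le ((natDegree_C_mul_le _ _).trans hnd) ?_)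
    simpa using (natDegree_C_mul_X_mul_derivative_le 1 P).trans hnd
  have key : ∀ s : ℂ, (∀ w : ℂ, w ≠ 0 → (P.eval w = s * w ^ n ↔
      l * (w * (derivative P).eval w - n * P.eval w) = s * w ^ n)) → ∀ w : ℂ, w ≠ 0 →
      ((reflect n P).eval w = s ↔ -l * w * (derivative (reflect n P)).eval w = s) := by
    intro s hs w hw
    have h1 := hs w⁻¹ (inv_ne_zero hw)
    have h2 := eval_reflect hdE (inv_ne_zero hw)
    have h3 := congrArg (eval w) (X_mul_derivative_reflect hnd)
    rw [inv_inv, ← h3] at h2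
    simp only [eval_sub, eval_mul, eval_C, eval_X] at h2
    have hpow : w⁻¹ ^ n ≠ 0 := pow_ne_zero n (inv_ne_zero hw)
    rw [show l * (w⁻¹ * (derivative P).eval w⁻¹ - n * P.eval w⁻¹) =
      -l * w * (derivative (reflect n P)).eval w * w⁻¹ ^ n by linear_combination -l * h2,
      eval_reflect hnd (inv_ne_zero hw), inv_inv, mul_left_inj' hpow, mul_left_inj' hpow] at h1
    exact h1
  have hdr : n ≤ (reflect n P).natDegree := by
    refine le_natDegree_of_ne_zero ?_
    rwa [coeff_reflect, revAt_le le_rfl, Nat.sub_self, coeff_zero_eq_eval_zero]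
  have h1 := eq_C_mul_X_mul_derivative_of_share (neg_ne_zero.2 hl) (hn.trans_le hdr) hab
    (key a ha) (key b hb)
  have h2 : reflect n P = reflect n (C (-l) * (C (n : ℂ) * P - X * derivative P)) := by
    rw [reflect_C_mul, ← X_mul_derivative_reflect hnd, ← mul_assoc]
    exact h1
  have h3 := congrArg (reflect n) h2
  rw [reflect_reflect, reflect_reflect] at h3
  conv_lhs => rw [h3]
  simp only [C_neg]
  ring

theorem eq_C_mul_X_pow_of_eval_ne_zero {K : Type*} [Field K] [IsAlgClosed K] {Q : K[X]}
    (hQ : Q ≠ 0) (h : ∀ w, w ≠ 0 → Q.eval w ≠ 0) :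
    ∃ (c : K) (n : ℕ), c ≠ 0 ∧ Q = C c * X ^ n := by
  obtain ⟨g, hg, hndvd⟩ := exists_eq_pow_rootMultiplicity_mul_and_not_dvd Q hQ 0
  generalize Q.rootMultiplicity 0 = n at hg
  rw [C_0, sub_zero] at hg hndvd
  have hdeg : g.degree = 0 := by
    by_contra hdeg
    obtain ⟨w, hw⟩ := IsAlgClosed.exists_root g hdeg
    rcases eq_or_ne w 0 with rfl | hw0
    · exact hndvd (X_dvd_iff.2 (by rwa [coeff_zero_eq_eval_zero]))
    · exact h w hw0 (by rw [hg, eval_mul, hw.eq_zero, mul_zero])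
  refine ⟨g.coeff 0, n, fun h0 => hndvd (X_dvd_iff.2 h0), ?_⟩
  rw [← eq_C_of_degree_eq_zero hdeg, mul_comm]
  exact hg


/-- If a non-constant rational function `R = P/Q` without poles in `ℂ* = ℂ∖{0}` and
`∂_z R` share two distinct finite values in `ℂ*`, then `R ≡ ∂_z R`. -/
theorem R_dzR_no_poles_share_two_values
    (l : ℂ) (hl : l ≠ 0)
    (P Q : ℂ[X]) (hPQ : IsCoprime P Q) (hQ : Q ≠ 0)
    (hd : 1 ≤ max P.natDegree Q.natDegree)
    (hnopoles : ∀ w : ℂ, w ≠ 0 → Q.eval w ≠ 0)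
    (a b : ℂ) (hab : a ≠ b)
    (hsharea : ∀ w : ℂ, w ≠ 0 → Q.eval w ≠ 0 →
      (P.eval w = a * Q.eval w ↔
        l * w * (derivative P * Q - P * derivative Q).eval w = a * (Q.eval w) ^ 2))
    (hshareb : ∀ w : ℂ, w ≠ 0 → Q.eval w ≠ 0 →
      (P.eval w = b * Q.eval w ↔
        l * w * (derivative P * Q - P * derivative Q).eval w = b * (Q.eval w) ^ 2)) :
    P * Q = C l * X * (derivative P * Q - P * derivative Q) := by
  obtain ⟨c, n, hc, rfl⟩ := eq_C_mul_X_pow_of_eval_ne_zero hQ hnopoles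
  have hW : C l * X * (derivative P * (C c * X ^ n) - P * derivative (C c * X ^ n)) =
      C c * X ^ n * (C l * (X * derivative P - C (n : ℂ) * P)) := by
    rcases n with _ | n
    · simp
      ring
    · rw [derivative_C_mul_X_pow, C_mul]
      simp only [Nat.add_sub_cancel]
      ring
  have hshare : ∀ s : ℂ, (∀ w : ℂ, w ≠ 0 → (C c * X ^ n : ℂ[X]).eval w ≠ 0 →
      (P.eval w = s * (C c * X ^ n : ℂ[X]).eval w ↔
        l * w * (derivative P * (C c * X ^ n) - P * derivative (C c * X ^ n)).eval w =
          s * ((C c * X ^ n : ℂ[X]).eval w) ^ 2)) → ∀ w : ℂ, w ≠ 0 →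
      (P.eval w = s * c * w ^ n ↔
        l * (w * (derivative P).eval w - n * P.eval w) = s * c * w ^ n) := by
    intro s hs w hw
    have h1 := hs w hw (hnopoles w hw)
    have h2 := congrArg (eval w) hW
    have hcw : c * w ^ n ≠ 0 := mul_ne_zero hc (pow_ne_zero n hw)
    rw [eval_mul, eval_mul, eval_C, eval_X] at h2
    rw [h2] at h1
    simp only [eval_mul, eval_sub, eval_C, eval_X, eval_pow] at h1
    rw [show s * (c * w ^ n) ^ 2 = c * w ^ n * (s * c * w ^ n) by ring, mul_right_inj' hcw,
      ← mul_assoc] at h1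
    exact h1
  have ha := hshare a hsharea
  have hb := hshare b hshareb
  have hab' : a * c ≠ b * c := fun h => hab (mul_right_cancel₀ hc h)
  suffices h : P = C l * (X * derivative P - C (n : ℂ) * P) by
    rw [hW, ← h, mul_comm]
  rw [natDegree_C_mul_X_pow n c hc] at hd
  rcases Nat.eq_zero_or_pos n with rfl | hn
  · have := eq_C_mul_X_mul_derivative_of_share hl (by simpa using hd) hab'
      (fun w hw => by simpa [mul_assoc] using ha w hw)
      (fun w hw => by simpa [mul_assoc] using hb w hw)
    simpa [mul_assoc] using this
  have hP0 : P.eval 0 ≠ 0 := by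
    intro h0
    obtain ⟨u, v, huv⟩ := hPQ
    simpa [h0, hn.ne'] using congrArg (eval 0) huv
  rcases le_or_gt P.natDegree n with hPn | hPn
  · exact eq_of_share_of_natDegree_le hl hn hPn hP0 hab' ha hb
  rcases eq_or_ne b 0 with rfl | hb0
  · exact eq_of_share_of_lt_natDegree hn hPn hP0 hab'.symm (mul_ne_zero hab hc)
      (fun w hw => (hb w hw).1) (fun w hw => (ha w hw).1)
  · exact eq_of_share_of_lt_natDegree hn hPn hP0 hab' (mul_ne_zero hb0 hc)
      (fun w hw => (ha w hw).1) (fun w hw => (hb w hw).1)
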